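/- For every integer k with 1 ≤ k ≤ d−1, the degree of the vertex p(U_d^k) of the White Whale H_∞^+(d,1) equals the binomial coefficient C(d, k); that is, the number of vectors g ∈ G_d such that either g ∈ U_d^k and p(U_d^k \ {g}) is a vertex of H_∞^+(d,1), or g ∉ U_d^k and p(U_d^k ∪ {g}) is a vertex of H_∞^+(d,1), equals C(d, k). -/

import Mathlib

/-- The set `G_d` of generators of the White Whale:
all nonzero 0/1-valued vectors of `ℝ^d`. -/
def whaleGens (d : ℕ) : Set (Fin d → ℝ) :=
  {g | g ≠ 0 ∧ ∀ i, g i = 0 ∨ g i = 1}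

/-- The point `p(S)`: the sum of the vectors in `S` (with `p(∅) = 0`). -/
noncomputable def whaleSum {d : ℕ} (S : Set (Fin d → ℝ)) : Fin d → ℝ :=
  ∑ᶠ g ∈ S, g

/-- The White Whale `H_∞^+(d,1)`: the convex hull of the points `p(S)`
over all subsets `S ⊆ G_d`. -/
noncomputable def whiteWhale (d : ℕ) : Set (Fin d → ℝ) :=
  convexHull ℝ {x | ∃ S : Set (Fin d → ℝ), S ⊆ whaleGens d ∧ x = whaleSum S}

/-- A vertex of the White Whale is an extreme point of it. -/
def IsWhaleVertex (d : ℕ) (x : Fin d → ℝ) : Prop :=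
  x ∈ Set.extremePoints ℝ (whiteWhale d)

/-- The set U_d^k: vectors of G_d whose last coordinate is 1 and which have
at most k nonzero coordinates. -/
def whaleU (d k : ℕ) (hd : 0 < d) : Set (Fin d → ℝ) :=
  {g | g ∈ whaleGens d ∧ g ⟨d - 1, Nat.sub_lt hd one_pos⟩ = 1 ∧
       {i : Fin d | g i ≠ 0}.ncard ≤ k}

open Finset

/-- The 0/1-valued indicator vector of a set of coordinates. -/
def indicatorVec {d : ℕ} (A : Finset (Fin d)) : Fin d → ℝ :=
  fun i => if i ∈ A then 1 else 0

theorem indicatorVec_injective {d : ℕ} :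
    Function.Injective (indicatorVec : Finset (Fin d) → Fin d → ℝ) := by
  intro A B h
  ext i
  have := congrFun h i
  by_cases hA : i ∈ A <;> by_cases hB : i ∈ B <;> simp_all [indicatorVec]

theorem indicatorVec_mem_whaleGens {d : ℕ} {A : Finset (Fin d)} :
    indicatorVec A ∈ whaleGens d ↔ A.Nonempty := by
  constructor
  · rintro ⟨h, -⟩
    by_contra hA
    rw [not_nonempty_iff_eq_empty] at hA
    exact h (by ext i; simp [indicatorVec, hA])
  · rintro ⟨i, hi⟩
    refine ⟨fun h => ?_, fun j => ?_⟩
    · simpa [indicatorVec, hi] using congrFun h i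
    · by_cases hj : j ∈ A <;> simp [indicatorVec, hj]

theorem exists_indicatorVec_eq {d : ℕ} {g : Fin d → ℝ} (hg : g ∈ whaleGens d) :
    ∃ A : Finset (Fin d), A.Nonempty ∧ g = indicatorVec A := by
  have h : g = indicatorVec (univ.filter fun i => g i = 1) := by
    ext i
    rcases hg.2 i with h | h <;> simp [indicatorVec, h]
  exact ⟨_, indicatorVec_mem_whaleGens.1 (h ▸ hg), h⟩

theorem indicatorVec_insert {d : ℕ} {A : Finset (Fin d)} {i : Fin d} (hi : i ∉ A) :
    indicatorVec (insert i A) = indicatorVec {i} + indicatorVec A := by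
  ext j
  by_cases hj : j = i
  · subst hj; simp [indicatorVec, hi]
  · simp [indicatorVec, hj]

theorem whaleGens_finite (d : ℕ) : (whaleGens d).Finite :=
  (Set.finite_range (indicatorVec (d := d))).subset fun _ hg =>
    let ⟨A, _, h⟩ := exists_indicatorVec_eq hg
    ⟨A, h.symm⟩

theorem whaleSum_mem_whiteWhale {d : ℕ} {S : Set (Fin d → ℝ)} (hS : S ⊆ whaleGens d) :
    whaleSum S ∈ whiteWhale d :=
  subset_convexHull ℝ _ ⟨S, hS, rfl⟩

theorem whaleSum_insert {d : ℕ} {S : Set (Fin d → ℝ)} (hS : S ⊆ whaleGens d)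
    {g : Fin d → ℝ} (hg : g ∉ S) : whaleSum (insert g S) = g + whaleSum S :=
  finsum_mem_insert _ hg ((whaleGens_finite d).subset hS)

theorem not_isWhaleVertex_of_add_sub_mem {d : ℕ} {x v : Fin d → ℝ} (hv : v ≠ 0)
    (h₁ : x + v ∈ whiteWhale d) (h₂ : x - v ∈ whiteWhale d) : ¬ IsWhaleVertex d x := by
  intro h
  refine hv ?_
  have := h.2 h₁ h₂ ⟨1 / 2, 1 / 2, by norm_num, by norm_num, by norm_num, by
    ext i; simp; ring⟩
  simpa using this

/-- The generators selected by a vertex are closed under addition inside the set of generators. -/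
theorem IsWhaleVertex.add_mem {d : ℕ} {S : Set (Fin d → ℝ)} (hS : S ⊆ whaleGens d)
    (h : IsWhaleVertex d (whaleSum S)) {g₁ g₂ : Fin d → ℝ} (h₁ : g₁ ∈ S) (h₂ : g₂ ∈ S)
    (hne : g₁ ≠ g₂) (hg : g₁ + g₂ ∈ whaleGens d) : g₁ + g₂ ∈ S := by
  by_contra h₃
  have hT : S \ {g₁, g₂} ⊆ whaleGens d := Set.sdiff_subset.trans hS
  have hT₂ : insert g₂ (S \ {g₁, g₂}) ⊆ whaleGens d := Set.insert_subset (hS h₂) hT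
  have hsum : whaleSum S = g₁ + (g₂ + whaleSum (S \ {g₁, g₂})) := by
    rw [← whaleSum_insert hT (by simp), ← whaleSum_insert hT₂ (by simp [hne])]
    congr 1
    ext x
    by_cases hx₁ : x = g₁ <;> by_cases hx₂ : x = g₂ <;> simp_all
  refine not_isWhaleVertex_of_add_sub_mem hg.1 ?_ ?_ h
  · rw [add_comm, ← whaleSum_insert hS h₃]
    exact whaleSum_mem_whiteWhale (Set.insert_subset hg hS)
  · rw [hsum, ← add_assoc, add_sub_cancel_left]
    exact whaleSum_mem_whiteWhale hT

/-- The generators not selected by a vertex are closed under addition inside the set of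
generators. -/
theorem IsWhaleVertex.add_notMem {d : ℕ} {S : Set (Fin d → ℝ)} (hS : S ⊆ whaleGens d)
    (h : IsWhaleVertex d (whaleSum S)) {g₁ g₂ : Fin d → ℝ} (hg₁ : g₁ ∈ whaleGens d)
    (hg₂ : g₂ ∈ whaleGens d) (h₁ : g₁ ∉ S) (h₂ : g₂ ∉ S) (hne : g₁ ≠ g₂) : g₁ + g₂ ∉ S := by
  intro h₃
  have hT : S \ {g₁ + g₂} ⊆ whaleGens d := Set.sdiff_subset.trans hS
  have hsum : whaleSum S = (g₁ + g₂) + whaleSum (S \ {g₁ + g₂}) := by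
    rw [← whaleSum_insert hT (by simp), Set.insert_sdiff_singleton, Set.insert_eq_of_mem h₃]
  refine not_isWhaleVertex_of_add_sub_mem (hS h₃).1 ?_ ?_ h
  · have hT₂ : insert g₂ S ⊆ whaleGens d := Set.insert_subset hg₂ hS
    rw [add_comm, add_assoc, ← whaleSum_insert hS h₂, ← whaleSum_insert hT₂ (by simp [hne, h₁])]
    exact whaleSum_mem_whiteWhale (Set.insert_subset hg₁ hT₂)
  · rw [hsum, add_sub_cancel_left]
    exact whaleSum_mem_whiteWhale hT

/-- If `i ∉ A` and, for a vertex `S`, both `i` and `A` are selected, then so is their union. -/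
theorem IsWhaleVertex.insert_mem {d : ℕ} {S : Set (Fin d → ℝ)} (hS : S ⊆ whaleGens d)
    (h : IsWhaleVertex d (whaleSum S)) {A : Finset (Fin d)} {i : Fin d} (hi : i ∉ A)
    (h₁ : indicatorVec {i} ∈ S) (h₂ : indicatorVec A ∈ S) : indicatorVec (insert i A) ∈ S := by
  rw [indicatorVec_insert hi]
  refine h.add_mem hS h₁ h₂ (fun e => hi ?_) ?_
  · rw [← indicatorVec_injective e]; simp
  · rw [← indicatorVec_insert hi, indicatorVec_mem_whaleGens]; simp

theorem IsWhaleVertex.insert_notMem {d : ℕ} {S : Set (Fin d → ℝ)} (hS : S ⊆ whaleGens d)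
    (h : IsWhaleVertex d (whaleSum S)) {A : Finset (Fin d)} {i : Fin d} (hi : i ∉ A)
    (hA : A.Nonempty) (h₁ : indicatorVec {i} ∉ S) (h₂ : indicatorVec A ∉ S) :
    indicatorVec (insert i A) ∉ S := by
  rw [indicatorVec_insert hi]
  refine h.add_notMem hS (indicatorVec_mem_whaleGens.2 (by simp))
    (indicatorVec_mem_whaleGens.2 hA) h₁ h₂ (fun e => hi ?_)
  rw [← indicatorVec_injective e]; simp

theorem map_whaleSum_lt {d : ℕ} {S T : Set (Fin d → ℝ)} (hS : S ⊆ whaleGens d)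
    (hT : T ⊆ whaleGens d) (l : (Fin d → ℝ) →ₗ[ℝ] ℝ) (hpos : ∀ g ∈ S, 0 < l g)
    (hneg : ∀ g ∈ whaleGens d, g ∉ S → l g < 0) (hne : T ≠ S) :
    l (whaleSum T) < l (whaleSum S) := by
  classical
  have key : ∀ R : Set (Fin d → ℝ), R ⊆ whaleGens d →
      l (whaleSum R) = ∑ g ∈ (whaleGens_finite d).toFinset, if g ∈ R then l g else 0 := by
    intro R hR
    rw [whaleSum, finsum_mem_eq_finite_toFinset_sum _ ((whaleGens_finite d).subset hR), map_sum,
      ← sum_filter]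
    refine sum_congr ?_ fun _ _ => rfl
    ext g
    simpa using fun hg => hR hg
  rw [key T hT, key S hS]
  refine sum_lt_sum (fun g hg => ?_) ?_
  · rw [Set.Finite.mem_toFinset] at hg
    by_cases h₁ : g ∈ S <;> by_cases h₂ : g ∈ T <;> simp only [h₁, h₂, if_true, if_false, le_refl]
    · exact (hpos g h₁).le
    · exact (hneg g hg h₁).le
  · have : ∃ g, ¬ (g ∈ T ↔ g ∈ S) := by
      by_contra! h
      exact hne (Set.ext h)
    obtain ⟨g, hg⟩ := this
    by_cases h₁ : g ∈ S
    · have h₂ : g ∉ T := fun h => hg (iff_of_true h h₁)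
      exact ⟨g, by simpa using hS h₁, by simpa [h₁, h₂] using hpos g h₁⟩
    · have h₂ : g ∈ T := by_contra fun h => hg (iff_of_false h h₁)
      exact ⟨g, by simpa using hT h₂, by simpa [h₁, h₂] using hneg g (hT h₂) h₁⟩

/-- A set of generators cut out by the strict sign of a linear functional gives a vertex. -/
theorem isWhaleVertex_of_separating {d : ℕ} {S : Set (Fin d → ℝ)} (hS : S ⊆ whaleGens d)
    (l : (Fin d → ℝ) →ₗ[ℝ] ℝ) (hpos : ∀ g ∈ S, 0 < l g)
    (hneg : ∀ g ∈ whaleGens d, g ∉ S → l g < 0) : IsWhaleVertex d (whaleSum S) := by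
  have hsub : whiteWhale d ⊆ {y | y = whaleSum S ∨ l y < l (whaleSum S)} := by
    refine convexHull_min ?_ ?_
    · rintro _ ⟨T, hT, rfl⟩
      by_cases hne : T = S
      · exact Or.inl (by rw [hne])
      · exact Or.inr (map_whaleSum_lt hS hT l hpos hneg hne)
    · refine convex_iff_forall_pos.2 fun x hx y hy a b ha hb hab => ?_
      by_cases h : x = whaleSum S ∧ y = whaleSum S
      · left
        rw [h.1, h.2, ← add_smul, hab, one_smul]
      · right
        rw [map_add, map_smul, map_smul, smul_eq_mul, smul_eq_mul]
        have e : l (whaleSum S) = a * l (whaleSum S) + b * l (whaleSum S) := by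
          rw [← add_mul, hab, one_mul]
        rw [e]
        rcases hx with rfl | hx <;> rcases hy with rfl | hy
        · exact absurd ⟨rfl, rfl⟩ h
        · gcongr
        · gcongr
        · gcongr
  refine ⟨whaleSum_mem_whiteWhale hS, ?_⟩
  rintro x hx y hy ⟨a, b, ha, hb, hab, hxy⟩
  by_contra hne
  have hx' : l x < l (whaleSum S) := (hsub hx).resolve_left hne
  have hy' : l y ≤ l (whaleSum S) := by
    rcases hsub hy with h | h
    · rw [h]
    · exact h.le
  have hl : a * l x + b * l y = l (whaleSum S) := by
    rw [← hxy, map_add, map_smul, map_smul, smul_eq_mul, smul_eq_mul]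
  have e : l (whaleSum S) = a * l (whaleSum S) + b * l (whaleSum S) := by
    rw [← add_mul, hab, one_mul]
  have h₁ := mul_lt_mul_of_pos_left hx' ha
  have h₂ := mul_le_mul_of_nonneg_left hy' hb.le
  linarith

/-- A functional whose value on the indicator vectors of sets containing `n` is governed by their
size, with ties broken by the distance to `A`. -/
theorem exists_tilted_functional {d : ℕ} (n : Fin d) (A : Finset (Fin d)) (s : ℝ) :
    ∃ l : (Fin d → ℝ) →ₗ[ℝ] ℝ, ∀ B : Finset (Fin d),
      l (indicatorVec B) = -(2 * d + 2) * #B + 2 * s * #(B \ A) +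
        if n ∈ B then (2 * d + 2) * #A - s else 0 := by
  classical
  let c : Fin d → ℝ := fun i => -(2 * d + 2) + (if i ∉ A then 2 * s else 0) +
    if i = n then (2 * d + 2) * #A - s else 0
  refine ⟨∑ i, c i • LinearMap.proj i, fun B => ?_⟩
  have : (∑ i, c i • LinearMap.proj (R := ℝ) (φ := fun _ : Fin d => ℝ) i) (indicatorVec B)
      = ∑ i ∈ B, c i := by
    simp [indicatorVec]
  rw [this]
  simp only [c, sum_add_distrib, sum_const, nsmul_eq_mul, ← sum_filter, sdiff_eq_filter,
    filter_eq']
  split_ifs <;> simp <;> ring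

theorem tilted_signs {d : ℕ} {n : Fin d} {A : Finset (Fin d)} (hA : n ∈ A) {s : ℝ}
    (hs : s = 1 ∨ s = -1) :
    ∃ l : (Fin d → ℝ) →ₗ[ℝ] ℝ, l (indicatorVec A) = -s ∧
      (∀ B : Finset (Fin d), B.Nonempty → n ∉ B → l (indicatorVec B) < 0) ∧
      (∀ B : Finset (Fin d), n ∈ B → #B < #A → 0 < l (indicatorVec B)) ∧
      (∀ B : Finset (Fin d), n ∈ B → #A < #B → l (indicatorVec B) < 0) ∧
      (∀ B : Finset (Fin d), n ∈ B → #B = #A → B ≠ A → 0 < s * l (indicatorVec B)) := by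
  obtain ⟨l, hl⟩ := exists_tilted_functional n A s
  have hr : ∀ B : Finset (Fin d), (#(B \ A) : ℝ) ≤ d := fun B => by
    exact_mod_cast (card_le_univ (B \ A)).trans_eq (Fintype.card_fin d)
  have hr₀ : ∀ B : Finset (Fin d), (0 : ℝ) ≤ #(B \ A) := fun B => Nat.cast_nonneg _
  refine ⟨l, ?_, fun B hB hn => ?_, fun B hn hc => ?_, fun B hn hc => ?_, fun B hn hc hne => ?_⟩
  · rw [hl, if_pos hA, sdiff_self]; simp; ring
  · have h₁ : (1 : ℝ) ≤ #B := by exact_mod_cast hB.card_pos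
    rw [hl, if_neg hn]
    rcases hs with rfl | rfl <;> nlinarith [hr B, hr₀ B]
  · have h₁ : (#B : ℝ) + 1 ≤ #A := by exact_mod_cast hc
    rw [hl, if_pos hn]
    rcases hs with rfl | rfl <;> nlinarith [hr B, hr₀ B]
  · have h₁ : (#A : ℝ) + 1 ≤ #B := by exact_mod_cast hc
    rw [hl, if_pos hn]
    rcases hs with rfl | rfl <;> nlinarith [hr B, hr₀ B]
  · have h₁ : (1 : ℝ) ≤ #(B \ A) := by
      have : 0 < #(B \ A) := by
        rw [card_pos, sdiff_nonempty]
        exact fun h => hne (eq_of_subset_of_card_le h hc.ge)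
      exact_mod_cast this
    rw [hl, if_pos hn, hc]
    rcases hs with rfl | rfl <;> linarith

theorem whaleU_subset {d k : ℕ} (hd : 0 < d) : whaleU d k hd ⊆ whaleGens d := fun _ h => h.1

theorem indicatorVec_mem_whaleU {d k : ℕ} (hd : 0 < d) {A : Finset (Fin d)} :
    indicatorVec A ∈ whaleU d k hd ↔ ⟨d - 1, Nat.sub_lt hd one_pos⟩ ∈ A ∧ #A ≤ k := by
  have h : {i : Fin d | indicatorVec A i ≠ 0} = (A : Set (Fin d)) := by
    ext i; simp [indicatorVec]
  rw [whaleU, Set.mem_ofPred_eq, indicatorVec_mem_whaleGens, h, Set.ncard_coe_finset]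
  constructor
  · rintro ⟨-, h₁, h₂⟩
    exact ⟨by simpa [indicatorVec] using h₁, h₂⟩
  · rintro ⟨h₁, h₂⟩
    exact ⟨⟨_, h₁⟩, by simpa [indicatorVec] using h₁, h₂⟩

theorem isWhaleVertex_whaleU_diff_iff {d k : ℕ} (hd : 0 < d) (hk : k ≤ d)
    {A : Finset (Fin d)} (hA : indicatorVec A ∈ whaleU d k hd) :
    IsWhaleVertex d (whaleSum (whaleU d k hd \ {indicatorVec A})) ↔ #A = k := by
  have hS : whaleU d k hd \ {indicatorVec A} ⊆ whaleGens d :=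
    Set.sdiff_subset.trans (whaleU_subset hd)
  have hAm := (indicatorVec_mem_whaleU hd).1 hA
  constructor
  · intro h
    by_contra hne
    have hlt : #A < k := lt_of_le_of_ne hAm.2 hne
    obtain ⟨i, hi⟩ : ∃ i, i ∉ A := by
      by_contra! hall
      rw [eq_univ_iff_forall.2 hall, card_univ, Fintype.card_fin] at hlt
      omega
    refine h.insert_notMem hS hi ⟨_, hAm.1⟩ (fun hm => ?_) (by simp) ⟨?_, fun e => ?_⟩
    · have := ((indicatorVec_mem_whaleU hd).1 hm.1).1
      rw [mem_singleton] at this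
      exact hi (this ▸ hAm.1)
    · rw [indicatorVec_mem_whaleU, card_insert_of_notMem hi]
      exact ⟨mem_insert_of_mem hAm.1, hlt⟩
    · exact hi (indicatorVec_injective e ▸ mem_insert_self i A)
  · intro hc
    obtain ⟨l, h₀, h₁, h₂, h₃, h₄⟩ := tilted_signs hAm.1 (Or.inl rfl : (1 : ℝ) = 1 ∨ _)
    refine isWhaleVertex_of_separating hS l (fun g hg => ?_) (fun g hg hgS => ?_)
    · obtain ⟨B, -, rfl⟩ := exists_indicatorVec_eq (hS hg)
      have hB := (indicatorVec_mem_whaleU hd).1 hg.1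
      have hne : B ≠ A := fun e => hg.2 (by rw [e]; rfl)
      rcases lt_or_eq_of_le (hc ▸ hB.2 : #B ≤ #A) with h | h
      · exact h₂ B hB.1 h
      · simpa using h₄ B hB.1 h hne
    · obtain ⟨B, hB, rfl⟩ := exists_indicatorVec_eq hg
      by_cases hn : ⟨d - 1, Nat.sub_lt hd one_pos⟩ ∈ B
      · by_cases hcB : #B ≤ k
        · have : B = A := by
            by_contra hne
            exact hgS ⟨(indicatorVec_mem_whaleU hd).2 ⟨hn, hcB⟩,
              fun e => hne (indicatorVec_injective e)⟩
          rw [this, h₀]; norm_num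
        · exact h₃ B hn (by omega)
      · exact h₁ B hB hn

theorem isWhaleVertex_whaleU_union_iff {d k : ℕ} (hd : 0 < d) (hk1 : 1 ≤ k) (hk2 : k < d)
    {A : Finset (Fin d)} (hA₀ : A.Nonempty) (hA : indicatorVec A ∉ whaleU d k hd) :
    IsWhaleVertex d (whaleSum (whaleU d k hd ∪ {indicatorVec A})) ↔
      ⟨d - 1, Nat.sub_lt hd one_pos⟩ ∈ A ∧ #A = k + 1 := by
  have hS : whaleU d k hd ∪ {indicatorVec A} ⊆ whaleGens d :=
    Set.union_subset (whaleU_subset hd)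
      (Set.singleton_subset_iff.2 (indicatorVec_mem_whaleGens.2 hA₀))
  have hmem : ∀ B : Finset (Fin d), indicatorVec B ∈ whaleU d k hd ∪ {indicatorVec A} ↔
      (⟨d - 1, Nat.sub_lt hd one_pos⟩ ∈ B ∧ #B ≤ k) ∨ B = A := fun B => by
    rw [Set.mem_union, indicatorVec_mem_whaleU, Set.mem_singleton_iff,
      indicatorVec_injective.eq_iff]
  rw [indicatorVec_mem_whaleU] at hA
  generalize (⟨d - 1, Nat.sub_lt hd one_pos⟩ : Fin d) = n at hA hmem ⊢
  constructor
  · intro h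
    have hsplit : ∀ i ∈ A, i ≠ n → 1 < #A → n ∈ A.erase i ∧ #(A.erase i) ≤ k := by
      intro i hi hin hc
      by_contra hcon
      have hne : A.erase i ≠ A := fun e => notMem_erase i A (e.symm ▸ hi)
      refine h.insert_notMem hS (notMem_erase i A) ?_ ?_ ?_ ((hmem _).2 (Or.inr (insert_erase hi)))
      · rw [← card_pos, card_erase_of_mem hi]; omega
      · rw [hmem]
        rintro (⟨h', -⟩ | rfl)
        · exact hin (mem_singleton.1 h').symm
        · simp at hc
      · rw [hmem]
        rintro (h' | h')
        · exact hcon h'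
        · exact hne h'
    by_cases hn : n ∈ A
    · refine ⟨hn, ?_⟩
      have hc : k < #A := by
        by_contra! hc
        exact hA ⟨hn, hc⟩
      obtain ⟨i, hi, hin⟩ := exists_mem_ne (by omega : 1 < #A) n
      have := (hsplit i hi hin (by omega)).2
      rw [card_erase_of_mem hi] at this
      omega
    · exfalso
      obtain ⟨i, hi⟩ := hA₀
      have hin : i ≠ n := fun e => hn (e ▸ hi)
      by_cases hc : 1 < #A
      · exact hn (mem_of_mem_erase (hsplit i hi hin hc).1)
      · have hAi : A = {i} :=
          (eq_of_subset_of_card_le (singleton_subset_iff.2 hi) (by simpa using hc)).symm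
        subst hAi
        obtain ⟨B, hnB, hBi, hBc⟩ : ∃ B : Finset (Fin d), {n} ⊆ B ∧ B ⊆ {i}ᶜ ∧ #B = k :=
          exists_subsuperset_card_eq (by simpa using hin) (by simpa using hk1)
            (by rw [card_compl, Fintype.card_fin, card_singleton]; omega)
        have hiB : i ∉ B := fun h' => by simpa using hBi h'
        have hnB' : n ∈ B := by simpa using hnB
        have := h.insert_mem hS hiB ((hmem _).2 (Or.inr rfl)) ((hmem _).2 (Or.inl ⟨hnB', hBc.le⟩))
        rw [hmem, card_insert_of_notMem hiB] at this
        rcases this with h' | h'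
        · omega
        · have : n ∈ ({i} : Finset (Fin d)) := h' ▸ mem_insert_of_mem hnB'
          exact hn this
  · rintro ⟨hn, hc⟩
    obtain ⟨l, h₀, h₁, h₂, h₃, h₄⟩ := tilted_signs hn (Or.inr rfl : (-1 : ℝ) = 1 ∨ _)
    refine isWhaleVertex_of_separating hS l (fun g hg => ?_) (fun g hg hgS => ?_)
    · obtain ⟨B, -, rfl⟩ := exists_indicatorVec_eq (hS hg)
      rcases (hmem B).1 hg with hB | rfl
      · exact h₂ B hB.1 (by omega)
      · rw [h₀]; norm_num
    · obtain ⟨B, hB, rfl⟩ := exists_indicatorVec_eq hg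
      rw [hmem] at hgS
      push Not at hgS
      by_cases hnB : n ∈ B
      · have hcB := hgS.1 hnB
        rcases (by omega : #A < #B ∨ #B = #A) with h | h
        · exact h₃ B hnB h
        · have := h₄ B hnB h hgS.2
          linarith
      · exact h₁ B hB hnB

/-- The degree of the vertex p(U_d^k) of the White Whale equals C(d, k). -/
theorem whaleU_degree (d k : ℕ) (hd : 2 ≤ d) (hk1 : 1 ≤ k) (hk2 : k ≤ d - 1) :
    {g | g ∈ whaleGens d ∧
      ((g ∈ whaleU d k (by omega) ∧
          IsWhaleVertex d (whaleSum (whaleU d k (by omega) \ {g}))) ∨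
       (g ∉ whaleU d k (by omega) ∧
          IsWhaleVertex d (whaleSum (whaleU d k (by omega) ∪ {g}))))}.ncard =
      d.choose k := by
  have hd₀ : 0 < d := by omega
  set n : Fin d := ⟨d - 1, Nat.sub_lt hd₀ one_pos⟩
  have hset : {g | g ∈ whaleGens d ∧
      ((g ∈ whaleU d k hd₀ ∧ IsWhaleVertex d (whaleSum (whaleU d k hd₀ \ {g}))) ∨
       (g ∉ whaleU d k hd₀ ∧ IsWhaleVertex d (whaleSum (whaleU d k hd₀ ∪ {g}))))} =
      (fun B => indicatorVec (insert n B)) ''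
        ((powersetCard k (univ : Finset (Fin d)) : Finset (Finset (Fin d))) : Set _) := by
    ext g
    simp only [Set.mem_ofPred_eq, Set.mem_image, mem_coe, mem_powersetCard_univ]
    constructor
    · rintro ⟨hg, h⟩
      obtain ⟨A, hA₀, rfl⟩ := exists_indicatorVec_eq hg
      rcases h with ⟨hA, h⟩ | ⟨hA, h⟩
      · rw [isWhaleVertex_whaleU_diff_iff hd₀ (by omega) hA] at h
        exact ⟨A, h, by rw [insert_eq_of_mem ((indicatorVec_mem_whaleU hd₀).1 hA).1]⟩
      · rw [isWhaleVertex_whaleU_union_iff hd₀ hk1 (by omega) hA₀ hA] at h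
        exact ⟨A.erase n, by rw [card_erase_of_mem h.1, h.2]; rfl, by rw [insert_erase h.1]⟩
    · rintro ⟨B, hB, rfl⟩
      refine ⟨indicatorVec_mem_whaleGens.2 (insert_nonempty n B), ?_⟩
      by_cases hnB : n ∈ B
      · have hU : indicatorVec B ∈ whaleU d k hd₀ :=
          (indicatorVec_mem_whaleU hd₀).2 ⟨hnB, hB.le⟩
        rw [insert_eq_of_mem hnB]
        exact Or.inl ⟨hU, (isWhaleVertex_whaleU_diff_iff hd₀ (by omega) hU).2 hB⟩
      · have hc : #(insert n B) = k + 1 := by rw [card_insert_of_notMem hnB, hB]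
        have hU : indicatorVec (insert n B) ∉ whaleU d k hd₀ := by
          rw [indicatorVec_mem_whaleU hd₀]
          omega
        exact Or.inr ⟨hU, (isWhaleVertex_whaleU_union_iff hd₀ hk1 (by omega)
          (insert_nonempty n B) hU).2 ⟨mem_insert_self n B, hc⟩⟩
  have hinj : Set.InjOn (fun B => indicatorVec (insert n B))
      ((powersetCard k (univ : Finset (Fin d)) : Finset (Finset (Fin d))) : Set _) := by
    intro B hB C hC h
    simp only [mem_coe, mem_powersetCard_univ] at hB hC
    have e : insert n B = insert n C := indicatorVec_injective h
    by_cases h₁ : n ∈ B <;> by_cases h₂ : n ∈ C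
    · rwa [insert_eq_of_mem h₁, insert_eq_of_mem h₂] at e
    · have := congrArg card e
      rw [insert_eq_of_mem h₁, card_insert_of_notMem h₂] at this
      omega
    · have := congrArg card e
      rw [insert_eq_of_mem h₂, card_insert_of_notMem h₁] at this
      omega
    · rw [← erase_insert h₁, e, erase_insert h₂]
  rw [hset, hinj.ncard_image, Set.ncard_coe_finset, card_powersetCard, card_univ,
    Fintype.card_fin]
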